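/- arXiv:2501.04186 — 4 statements merged into one kernel-verified Lean document; each statement's English description precedes it below -/
import Mathlib

section
/- Let n ≥ 2 and let B be a signed chord diagram on n chords whose intersection graph is the complete graph K_n, i.e. every pair of distinct chords is interlaced. Then ∂ε^×_B(z) = z^n + Σ_{i=1}^{n} C(n, n+1−i) z^i if n is even, and ∂ε^×_B(z) = z^{n−1} + Σ_{i=1}^{n} C(n, n+1−i) z^i if n is odd, where C(n, k) denotes the binomial coefficient. -/
open Finset Polynomial

/-- A signed chord diagram (bouquet) on a finite chord set `E` with `n` chords:
the `2*n` cyclic positions are labeled by chords via `chord`, each chord occupying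
exactly two positions, and each chord carries a sign (`true` = `+1` = untwisted,
`false` = `-1` = twisted). -/
structure Bouquet (n : ℕ) (E : Type) [Fintype E] [DecidableEq E] where
  chord : Fin (2 * n) → E
  sign : E → Bool
  fiber_two : ∀ e : E, (Finset.univ.filter fun i => chord i = e).card = 2

namespace Bouquet

variable {n : ℕ} {E : Type} [Fintype E] [DecidableEq E]

/-- The partial Petrial `B^{×|A}`: same chord diagram, signs flipped exactly on `A`. -/
def petrial (B : Bouquet n E) (A : Finset E) : Bouquet n E where
  chord := B.chord
  sign := fun e => if e ∈ A then !B.sign e else B.sign e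
  fiber_two := B.fiber_two

/-- The boundary graph on the `4*n` points `(i, b)` (with `b = true` meaning `i⁺` and
`b = false` meaning `i⁻`): the matching `σ` joins `i⁺` to `(i+1)⁻`, and the matching `τ`
joins, for each chord with endpoints `{i, j}`, the points `i⁺,j⁻` and `i⁻,j⁺` when the
sign is `+1`, and the points `i⁺,j⁺` and `i⁻,j⁻` when the sign is `-1`. -/
def boundaryGraph (B : Bouquet n E) : SimpleGraph (Fin (2 * n) × Bool) :=
  SimpleGraph.fromRel fun x y =>
    (x.2 = true ∧ y.2 = false ∧ y.1.val = (x.1.val + 1) % (2 * n)) ∨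
    (B.chord x.1 = B.chord y.1 ∧ x.1 ≠ y.1 ∧
      (if B.sign (B.chord x.1) then x.2 ≠ y.2 else x.2 = y.2))

/-- `f(B)`: the number of boundary components of `B`, i.e. the number of connected
components of the boundary graph. -/
noncomputable def numBoundary (B : Bouquet n E) : ℕ :=
  Nat.card B.boundaryGraph.ConnectedComponent

/-- The Euler genus `ε(B) = n + 1 - f(B)`. -/
noncomputable def eulerGenus (B : Bouquet n E) : ℕ :=
  n + 1 - B.numBoundary

/-- The partial Petrial polynomial `∂ε^×_B(z) = Σ_{A ⊆ E} z^{ε(B^{×|A})}`. -/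
noncomputable def petrialPoly (B : Bouquet n E) : Polynomial ℤ :=
  ∑ A : Finset E, Polynomial.X ^ (B.petrial A).eulerGenus

/-- Two distinct chords are interlaced if exactly one endpoint of the second lies in
one of the two open arcs determined by the endpoints of the first (expressed here by
cutting the circle between positions `2*n - 1` and `0`). -/
def Interlaced (B : Bouquet n E) (e e' : E) : Prop :=
  e ≠ e' ∧ ∃ i j : Fin (2 * n), B.chord i = e ∧ B.chord j = e ∧ i < j ∧
    (Finset.univ.filter fun k => B.chord k = e' ∧ i < k ∧ k < j).card = 1

/-- The intersection graph `I(B)`: vertices are the chords, two chords adjacent iff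
interlaced. -/
def intersectionGraph (B : Bouquet n E) : SimpleGraph E :=
  SimpleGraph.fromRel B.Interlaced

end Bouquet

namespace Bouquet

variable {n : ℕ} {E : Type} [Fintype E] [DecidableEq E]

theorem card_chords (B : Bouquet n E) : Fintype.card E = n := by
  have h := Finset.card_eq_sum_card_fiberwise (f := B.chord) (s := Finset.univ)
    (t := Finset.univ) (fun _ _ => Finset.mem_univ _)
  simp only [B.fiber_two, Finset.sum_const, Finset.card_univ, Fintype.card_fin,
    smul_eq_mul] at h
  omega

theorem eq_or_eq_of_chord_eq (B : Bouquet n E) {i j k : Fin (2 * n)} (hij : i ≠ j)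
    (hj : B.chord j = B.chord i) (hk : B.chord k = B.chord i) : k = i ∨ k = j := by
  by_contra! h
  have hsub : ({i, j, k} : Finset (Fin (2 * n))) ⊆
      Finset.univ.filter fun l => B.chord l = B.chord i := by
    intro l hl
    simp only [Finset.mem_insert, Finset.mem_singleton] at hl
    rcases hl with rfl | rfl | rfl <;> simp [*]
  have := Finset.card_le_card hsub
  rw [B.fiber_two, Finset.card_eq_three.2 ⟨i, j, k, hij, h.1.symm, h.2.symm, rfl⟩] at this
  omega

/-- If all chords are pairwise interlaced, the two endpoints of a chord are antipodal. -/
theorem exists_antipodal (hn : 2 ≤ n) (B : Bouquet n E)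
    (hB : ∀ e e' : E, e ≠ e' → B.Interlaced e e') (e : E) :
    ∃ i j : Fin (2 * n), B.chord i = e ∧ B.chord j = e ∧ j.val = i.val + n := by
  have : Nontrivial E := Fintype.one_lt_card_iff_nontrivial.1 (by rw [B.card_chords]; omega)
  obtain ⟨e', he'⟩ := exists_ne e
  obtain ⟨-, i, j, hi, hj, hij, -⟩ := hB e e' he'.symm
  refine ⟨i, j, hi, hj, ?_⟩
  have hcount : ∀ e'' : E, ((Finset.Ioo i j).filter fun k => B.chord k = e'').card =
      if e'' = e then 0 else 1 := by
    intro e''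
    split_ifs with h
    · subst h
      rw [Finset.card_eq_zero, Finset.filter_eq_empty_iff]
      intro k hk hke
      rw [Finset.mem_Ioo] at hk
      rcases B.eq_or_eq_of_chord_eq hij.ne (hj.trans hi.symm) (hke.trans hi.symm) with rfl | rfl
      · exact lt_irrefl _ hk.1
      · exact lt_irrefl _ hk.2
    · obtain ⟨-, i', j', hi', hj', hij', hc⟩ := hB e e'' (Ne.symm h)
      have h1 := B.eq_or_eq_of_chord_eq hij.ne (hj.trans hi.symm) (hi'.trans hi.symm)
      have h2 := B.eq_or_eq_of_chord_eq hij.ne (hj.trans hi.symm) (hj'.trans hi.symm)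
      have h3 : i' = i ∧ j' = j := by
        rcases h1 with rfl | rfl <;> rcases h2 with rfl | rfl
        · exact absurd hij' (lt_irrefl _)
        · exact ⟨rfl, rfl⟩
        · exact absurd hij' hij.asymm
        · exact absurd hij' (lt_irrefl _)
      obtain ⟨rfl, rfl⟩ := h3
      rw [← hc]
      congr 1
      ext k
      simp [and_comm]
  have h := Finset.card_eq_sum_card_fiberwise (f := B.chord) (s := Finset.Ioo i j)
    (t := Finset.univ) (fun _ _ => Finset.mem_univ _)
  rw [Finset.sum_congr rfl (fun e'' _ => hcount e''), Fin.card_Ioo] at h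
  have h' : ∑ x : E, (if x = e then 0 else 1) = n - 1 := by
    rw [← Finset.sum_erase_add _ _ (Finset.mem_univ e), if_pos rfl, add_zero,
      Finset.sum_congr rfl (g := fun _ => 1) (fun x hx => if_neg (Finset.ne_of_mem_erase hx))]
    simp [B.card_chords]
  rw [h'] at h
  have := Fin.lt_def.1 hij
  omega

theorem chord_eq_iff (hn : 2 ≤ n) (B : Bouquet n E)
    (hB : ∀ e e' : E, e ≠ e' → B.Interlaced e e') (i j : Fin (2 * n)) :
    B.chord i = B.chord j ↔ (n : ℤ) ∣ (i.val : ℤ) - j.val := by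
  obtain ⟨a, b, ha, hb, hab⟩ := exists_antipodal hn B hB (B.chord i)
  have hne : a ≠ b := by rintro rfl; omega
  have hi := B.eq_or_eq_of_chord_eq hne (hb.trans ha.symm) ha.symm
  constructor
  · intro h
    have hj := B.eq_or_eq_of_chord_eq hne (hb.trans ha.symm) (h.symm.trans ha.symm)
    rcases hi with rfl | rfl <;> rcases hj with rfl | rfl <;> simp [hab]
  · rintro ⟨k, hk⟩
    have hi' := i.isLt
    have hj' := j.isLt
    have hk2 : -2 < k := by by_contra! hc; nlinarith
    have hk3 : k < 2 := by by_contra! hc; nlinarith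
    have hj : j = a ∨ j = b := by
      have hb' := b.isLt
      simp only [Fin.ext_iff] at hi ⊢
      interval_cases k <;> omega
    rcases hj with rfl | rfl
    · exact ha.symm
    · exact hb.symm

/-- The position `z mod 2n` on the circle. -/
def pos (hn : 2 ≤ n) (z : ℤ) : Fin (2 * n) :=
  ⟨(z % (2 * n : ℕ)).toNat, by
    have h1 := Int.emod_nonneg z (b := ((2 * n : ℕ) : ℤ)) (by omega)
    have h2 := Int.emod_lt_of_pos z (b := ((2 * n : ℕ) : ℤ)) (by omega)
    omega⟩

theorem pos_val (hn : 2 ≤ n) (z : ℤ) : ((pos hn z).val : ℤ) = z % (2 * n : ℕ) :=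
  Int.toNat_of_nonneg (Int.emod_nonneg z (by omega))

theorem pos_eq_iff (hn : 2 ≤ n) (z w : ℤ) : pos hn z = pos hn w ↔ (2 * n : ℤ) ∣ z - w := by
  rw [Fin.ext_iff, ← Nat.cast_inj (R := ℤ), pos_val, pos_val, Int.emod_eq_emod_iff_emod_sub_eq_zero,
    ← Int.dvd_iff_emod_eq_zero]
  push_cast
  rfl

theorem pos_coe (hn : 2 ≤ n) (i : Fin (2 * n)) : pos hn (i.val : ℤ) = i := by
  rw [Fin.ext_iff, ← Nat.cast_inj (R := ℤ), pos_val, Int.emod_eq_of_lt] <;> omega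

theorem chord_pos_eq_iff (hn : 2 ≤ n) (B : Bouquet n E)
    (hB : ∀ e e' : E, e ≠ e' → B.Interlaced e e') (z w : ℤ) :
    B.chord (pos hn z) = B.chord (pos hn w) ↔ (n : ℤ) ∣ z - w := by
  rw [chord_eq_iff hn B hB, pos_val, pos_val]
  have h (x : ℤ) : (n : ℤ) ∣ x % (2 * n : ℕ) - x := by
    refine dvd_trans ?_ (dvd_sub_comm.1 (Int.dvd_self_sub_emod (x := x) (m := (2 * n : ℕ))))
    exact ⟨2, by push_cast; ring⟩
  have e : z % (2 * n : ℕ) - w % (2 * n : ℕ) =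
      (z - w) + ((z % (2 * n : ℕ) - z) - (w % (2 * n : ℕ) - w)) := by ring
  rw [e]
  exact dvd_add_left (dvd_sub (h z) (h w))

/-- The chord at position `z mod 2n` is twisted. -/
def TwistedAt (hn : 2 ≤ n) (B : Bouquet n E) (z : ℤ) : Prop :=
  B.sign (B.chord (pos hn z)) = false

/-- Labelings of the `2n` boundary arcs (the arc `z` joins `z⁺` to `(z+1)⁻`), for antipodal
chords, that are constant along boundary components. -/
structure IsArcInvariant (hn : 2 ≤ n) (B : Bouquet n E) {α : Type} (F : ℤ → α) : Prop where
  periodic : ∀ z, F (z + 2 * n) = F z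
  untwisted : ∀ z, ¬ B.TwistedAt hn z → F z = F (z - 1 + n)
  twisted : ∀ z, B.TwistedAt hn z → F z = F (z + n)
  twisted_pred : ∀ z, B.TwistedAt hn z → F (z - 1) = F (z - 1 + n)

theorem eq_of_dvd_sub {α : Type} {F : ℤ → α} {m : ℤ} (hF : ∀ z, F (z + m) = F z) {z w : ℤ}
    (h : m ∣ z - w) : F z = F w := by
  obtain ⟨k, hk⟩ := h
  have hp : Function.Periodic F m := hF
  have := hp.int_mul k w
  rw [← this]
  congr 1
  push_cast
  linear_combination hk

/-- The boundary component of the arc `z`. -/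
def arcComponent (hn : 2 ≤ n) (B : Bouquet n E) (z : ℤ) : B.boundaryGraph.ConnectedComponent :=
  B.boundaryGraph.connectedComponentMk (pos hn z, true)

theorem arcComponent_pred (hn : 2 ≤ n) (B : Bouquet n E) (z : ℤ) :
    arcComponent hn B (z - 1) = B.boundaryGraph.connectedComponentMk (pos hn z, false) := by
  refine SimpleGraph.ConnectedComponent.sound (SimpleGraph.Adj.reachable ?_)
  rw [boundaryGraph, SimpleGraph.fromRel_adj]
  refine ⟨by simp, Or.inl (Or.inl ⟨rfl, rfl, ?_⟩)⟩
  rw [← Nat.cast_inj (R := ℤ)]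
  push_cast
  rw [pos_val, pos_val]
  push_cast
  rw [Int.emod_add_emod]
  simp

theorem arcComponent_surjective (hn : 2 ≤ n) (B : Bouquet n E) :
    Function.Surjective (arcComponent hn B) := by
  intro c
  induction c using SimpleGraph.ConnectedComponent.ind with
  | h v =>
    obtain ⟨i, b⟩ := v
    cases b
    · exact ⟨i.val - 1, by rw [arcComponent_pred, pos_coe]⟩
    · exact ⟨i.val, by rw [arcComponent, pos_coe]⟩

theorem pos_ne_pos_add (hn : 2 ≤ n) (z : ℤ) : pos hn z ≠ pos hn (z + n) := by
  rw [Ne, pos_eq_iff]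
  rintro ⟨k, hk⟩
  have : (n : ℤ) * (1 + 2 * k) = 0 := by linarith
  rcases mul_eq_zero.1 this with h | h <;> omega

theorem isArcInvariant_arcComponent (hn : 2 ≤ n) (B : Bouquet n E)
    (hB : ∀ e e' : E, e ≠ e' → B.Interlaced e e') :
    IsArcInvariant hn B (arcComponent hn B) := by
  have hc (z : ℤ) : B.chord (pos hn z) = B.chord (pos hn (z + n)) := by
    rw [chord_pos_eq_iff hn B hB]
    simp
  have key (z : ℤ) (b b' : Bool)
      (h : if B.sign (B.chord (pos hn z)) then b ≠ b' else b = b') :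
      B.boundaryGraph.connectedComponentMk (pos hn z, b) =
        B.boundaryGraph.connectedComponentMk (pos hn (z + n), b') := by
    refine SimpleGraph.ConnectedComponent.sound (SimpleGraph.Adj.reachable ?_)
    rw [boundaryGraph, SimpleGraph.fromRel_adj]
    refine ⟨?_, Or.inl (Or.inr ⟨hc z, pos_ne_pos_add hn z, h⟩)⟩
    rw [Ne, Prod.mk.injEq, not_and]
    exact fun h' => absurd h' (pos_ne_pos_add hn z)
  refine ⟨fun z => ?_, fun z hz => ?_, fun z hz => ?_, fun z hz => ?_⟩
  · rw [arcComponent, (pos_eq_iff hn (z + 2 * n) z).2 (by simp)]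
    rfl
  · rw [show z - 1 + n = z + n - 1 by ring, arcComponent_pred]
    refine key z _ _ ?_
    rw [TwistedAt, Bool.not_eq_false] at hz
    simp [hz]
  · refine key z _ _ ?_
    rw [TwistedAt] at hz
    simp [hz]
  · rw [show z - 1 + n = z + n - 1 by ring, arcComponent_pred, arcComponent_pred]
    refine key z _ _ ?_
    rw [TwistedAt] at hz
    simp [hz]

/-- An arc-invariant labeling depends only on the boundary component. -/
theorem IsArcInvariant.eq_of_arcComponent_eq {hn : 2 ≤ n} {B : Bouquet n E}
    (hB : ∀ e e' : E, e ≠ e' → B.Interlaced e e') {α : Type} {F : ℤ → α}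
    (hF : IsArcInvariant hn B F) {z w : ℤ} (h : arcComponent hn B z = arcComponent hn B w) :
    F z = F w := by
  let G : Fin (2 * n) × Bool → α := fun v => if v.2 then F v.1.val else F (v.1.val - 1)
  have hrel : ∀ x y : Fin (2 * n) × Bool,
      ((x.2 = true ∧ y.2 = false ∧ y.1.val = (x.1.val + 1) % (2 * n)) ∨
      (B.chord x.1 = B.chord y.1 ∧ x.1 ≠ y.1 ∧
        (if B.sign (B.chord x.1) then x.2 ≠ y.2 else x.2 = y.2))) → G x = G y := by
    rintro ⟨i, b⟩ ⟨j, b'⟩ (⟨h1, h2, h3⟩ | ⟨h1, h2, h3⟩)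
    · simp only at h1 h2 h3
      subst h1 h2
      simp only [G, if_true, Bool.false_eq_true, if_false]
      refine eq_of_dvd_sub hF.periodic ?_
      have : ((j.val : ℕ) : ℤ) = (i.val + 1 : ℤ) % (2 * n) := by rw [h3]; push_cast; rfl
      have hd := Int.dvd_self_sub_emod (x := (i.val + 1 : ℤ)) (m := 2 * n)
      rw [this]
      convert hd using 1
      ring
    · simp only at h1 h2 h3
      have hd := (chord_eq_iff hn B hB i j).1 h1
      have hj : (2 * n : ℤ) ∣ (i.val + n : ℤ) - j.val := by
        obtain ⟨k, hk⟩ := hd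
        rcases Int.even_or_odd' k with ⟨l, rfl | rfl⟩
        · exfalso
          apply h2
          rw [← pos_coe hn i, ← pos_coe hn j, pos_eq_iff]
          exact ⟨l, by rw [hk]; ring⟩
        · exact ⟨l + 1, by linear_combination hk⟩
      have e1 : F (i.val + n) = F j.val := eq_of_dvd_sub hF.periodic hj
      have e2 : F (i.val - 1 + n) = F (j.val - 1) :=
        eq_of_dvd_sub hF.periodic (by convert hj using 1; ring)
      have e3 : F i.val = F (j.val + n) := by
        rw [← hF.periodic i.val]
        exact eq_of_dvd_sub hF.periodic (by convert hj using 1; ring)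
      have e4 : F (i.val - 1) = F (j.val - 1 + n) := by
        rw [← hF.periodic (i.val - 1)]
        exact eq_of_dvd_sub hF.periodic (by convert hj using 1; ring)
      by_cases hs : B.TwistedAt hn i.val
      · have ht := hF.twisted _ hs
        have htp := hF.twisted_pred _ hs
        rw [TwistedAt, pos_coe] at hs
        simp only [hs, Bool.false_eq_true, if_false] at h3
        subst h3
        cases b
        · simp only [G, Bool.false_eq_true, if_false]
          rw [htp, e2]
        · simp only [G, if_true]
          rw [ht, e1]
      · have hs' : ¬ B.TwistedAt hn j.val := by
          rwa [TwistedAt, pos_coe, ← h1, ← pos_coe hn i]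
        have hu := hF.untwisted _ hs
        have hu' := hF.untwisted _ hs'
        rw [TwistedAt, pos_coe, Bool.not_eq_false] at hs
        simp only [hs, if_true] at h3
        cases b <;> cases b'
        · exact absurd rfl h3
        · simp only [G, if_true, Bool.false_eq_true, if_false]
          rw [e4, hu']
        · simp only [G, if_true, Bool.false_eq_true, if_false]
          rw [hu, e2]
        · exact absurd rfl h3
  have hreach : ∀ x y, B.boundaryGraph.Reachable x y → G x = G y := by
    rintro x y ⟨p⟩
    induction p with
    | nil => rfl
    | cons hadj _ ih =>
      rw [← ih]
      rw [boundaryGraph, SimpleGraph.fromRel_adj] at hadj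
      rcases hadj.2 with h' | h'
      · exact hrel _ _ h'
      · exact (hrel _ _ h').symm
  have hG : ∀ x, G (pos hn x, true) = F x := by
    intro x
    simp only [G, if_true]
    refine eq_of_dvd_sub hF.periodic ?_
    rw [← pos_eq_iff hn, pos_coe]
  rw [← hG z, ← hG w]
  exact hreach _ _ (SimpleGraph.ConnectedComponent.exact h)

/-- A complete arc invariant counts the boundary components. -/
theorem IsArcInvariant.numBoundary_eq {hn : 2 ≤ n} {B : Bouquet n E}
    (hB : ∀ e e' : E, e ≠ e' → B.Interlaced e e') {α : Type} {F : ℤ → α}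
    (hF : IsArcInvariant hn B F) (hsurj : Function.Surjective F)
    (hinj : ∀ z w, F z = F w → arcComponent hn B z = arcComponent hn B w) :
    B.numBoundary = Nat.card α := by
  have hs := arcComponent_surjective hn B
  refine Nat.card_eq_of_bijective (fun c => F (Function.surjInv hs c)) ⟨?_, ?_⟩
  · intro c d h
    have := hinj _ _ h
    rwa [Function.surjInv_eq hs, Function.surjInv_eq hs] at this
  · intro a
    obtain ⟨z, rfl⟩ := hsurj a
    exact ⟨arcComponent hn B z,
      hF.eq_of_arcComponent_eq hB (Function.surjInv_eq hs _)⟩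

theorem twistedAt_congr (hn : 2 ≤ n) (B : Bouquet n E)
    (hB : ∀ e e' : E, e ≠ e' → B.Interlaced e e') {z w : ℤ} (h : (n : ℤ) ∣ z - w) :
    B.TwistedAt hn z ↔ B.TwistedAt hn w := by
  rw [TwistedAt, TwistedAt, (chord_pos_eq_iff hn B hB z w).2 h]

theorem exists_pos_chord_eq (hn : 2 ≤ n) (B : Bouquet n E) (e : E) :
    ∃ z : ℤ, B.chord (pos hn z) = e := by
  have h : (Finset.univ.filter fun i => B.chord i = e).Nonempty := by
    rw [← Finset.card_pos, B.fiber_two]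
    norm_num
  obtain ⟨i, hi⟩ := h
  exact ⟨i.val, by rw [pos_coe]; exact (Finset.mem_filter.1 hi).2⟩

theorem exists_twistedAt_sub (hn : 2 ≤ n) (B : Bouquet n E)
    (hB : ∀ e e' : E, e ≠ e' → B.Interlaced e e') {e : E} (he : B.sign e = false) (z : ℤ) :
    ∃ k : ℕ, B.TwistedAt hn (z - k) := by
  obtain ⟨w, rfl⟩ := exists_pos_chord_eq hn B e
  have h0 := Int.emod_nonneg (z - w) (b := (n : ℤ)) (by omega)
  refine ⟨((z - w) % n).toNat, ?_⟩
  rw [Int.toNat_of_nonneg h0]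
  refine (twistedAt_congr hn B hB ?_).2 he
  convert Int.dvd_self_sub_emod (x := z - w) (m := n) using 1
  ring

theorem arcComponent_of_twistedAt_sub (hn : 2 ≤ n) (B : Bouquet n E)
    (hB : ∀ e e' : E, e ≠ e' → B.Interlaced e e') (k : ℕ) :
    ∀ z : ℤ, B.TwistedAt hn (z - k) → (∀ l < k, ¬ B.TwistedAt hn (z - l)) →
      arcComponent hn B z = arcComponent hn B (z + n) ∧
        arcComponent hn B z = arcComponent hn B (z - k) := by
  have hR := isArcInvariant_arcComponent hn B hB
  induction k with
  | zero =>
    intro z hz _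
    rw [Nat.cast_zero, sub_zero] at hz ⊢
    exact ⟨hR.twisted z hz, rfl⟩
  | succ k ih =>
    intro z hz hlt
    have hz0 : ¬ B.TwistedAt hn z := by simpa using hlt 0 (Nat.succ_pos k)
    have hzn : ¬ B.TwistedAt hn (z + n) := by rwa [twistedAt_congr hn B hB (w := z) (by simp)]
    have e (l : ℕ) : z - 1 - l = z - (l + 1 : ℕ) := by push_cast; ring
    obtain ⟨h1, h2⟩ := ih (z - 1) (by rwa [e]) fun l hl => by rw [e]; exact hlt _ (by omega)
    have h3 := hR.untwisted z hz0
    have h4 := hR.untwisted (z + n) hzn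
    rw [show z + n - 1 + n = z - 1 + 2 * n by ring, hR.periodic] at h4
    rw [e] at h2
    exact ⟨by rw [h3, h4, h1], by rw [h3, ← h1, h2]⟩

open Classical in
/-- If some chord is twisted, the boundary components correspond to the twisted chords. -/
theorem numBoundary_of_twisted (hn : 2 ≤ n) (B : Bouquet n E)
    (hB : ∀ e e' : E, e ≠ e' → B.Interlaced e e') {e : E} (he : B.sign e = false) :
    B.numBoundary = (Finset.univ.filter fun e => B.sign e = false).card := by
  have hex := exists_twistedAt_sub hn B hB he
  let F : ℤ → {e : E // B.sign e = false} := fun z =>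
    ⟨B.chord (pos hn (z - Nat.find (hex z))), Nat.find_spec (hex z)⟩
  have hFt : ∀ z, B.TwistedAt hn z → (F z).1 = B.chord (pos hn z) := by
    intro z hz
    have : Nat.find (hex z) = 0 := by rw [Nat.find_eq_zero]; simpa using hz
    simp [F, this]
  have hFu : ∀ z, ¬ B.TwistedAt hn z → F z = F (z - 1) := by
    intro z hz
    have h1 : Nat.find (hex z) = Nat.find (hex (z - 1)) + 1 := by
      rw [Nat.find_eq_iff]
      have e (l : ℕ) : z - (l + 1 : ℕ) = z - 1 - l := by push_cast; ring
      refine ⟨by rw [e]; exact Nat.find_spec (hex (z - 1)), fun l hl => ?_⟩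
      cases l with
      | zero => simpa using hz
      | succ l => rw [e]; exact Nat.find_min (hex (z - 1)) (by omega)
    apply Subtype.ext
    simp only [F, h1]
    congr 2
    push_cast
    ring
  have hFn : ∀ z, F (z + n) = F z := by
    intro z
    have h (k : ℕ) : (n : ℤ) ∣ z + n - k - (z - k) := ⟨1, by ring⟩
    have h1 : Nat.find (hex (z + n)) = Nat.find (hex z) :=
      Nat.find_congr' fun {k} => twistedAt_congr hn B hB (h k)
    apply Subtype.ext
    simp only [F, h1]
    exact (chord_pos_eq_iff hn B hB _ _).2 (h _)
  have hF : IsArcInvariant hn B F := by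
    refine ⟨fun z => ?_, fun z hz => ?_, fun z _ => (hFn z).symm, fun z _ => (hFn _).symm⟩
    · rw [show z + 2 * (n : ℤ) = z + n + n by ring, hFn, hFn]
    · rw [hFn, hFu z hz]
  have hR := isArcInvariant_arcComponent hn B hB
  rw [hF.numBoundary_eq hB ?_ ?_, Nat.card_eq_fintype_card, Fintype.card_subtype]
  · rintro ⟨e', he'⟩
    obtain ⟨z, rfl⟩ := exists_pos_chord_eq hn B e'
    exact ⟨z, Subtype.ext (hFt z he')⟩
  · intro z w h
    have key := fun z => arcComponent_of_twistedAt_sub hn B hB _ z (Nat.find_spec (hex z))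
      fun l hl => Nat.find_min (hex z) hl
    rw [(key z).2, (key w).2]
    have hd := (chord_pos_eq_iff hn B hB _ _).1 (congrArg Subtype.val h)
    obtain ⟨k, hk⟩ := hd
    rcases Int.even_or_odd' k with ⟨l, rfl | rfl⟩
    · exact eq_of_dvd_sub hR.periodic ⟨l, by rw [hk]; ring⟩
    · rw [hR.twisted _ (Nat.find_spec (hex w))]
      exact eq_of_dvd_sub hR.periodic ⟨l, by linear_combination hk⟩

/-- Without twisted chords there are `1` or `2` boundary components, by parity of `n`. -/
theorem numBoundary_of_untwisted (hn : 2 ≤ n) (B : Bouquet n E)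
    (hB : ∀ e e' : E, e ≠ e' → B.Interlaced e e') (h : ∀ e, B.sign e = true) :
    B.numBoundary = if n % 2 = 0 then 1 else 2 := by
  have hu (z : ℤ) : ¬ B.TwistedAt hn z := by simp [TwistedAt, h]
  have hR := isArcInvariant_arcComponent hn B hB
  have hstep (z : ℤ) : arcComponent hn B (z + 2) = arcComponent hn B z := by
    rw [hR.untwisted _ (hu _), hR.untwisted _ (hu _), ← hR.periodic z]
    congr 1
    ring
  split_ifs with hpar
  · have hF : IsArcInvariant hn B fun _ => () := ⟨by simp, by simp, by simp, by simp⟩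
    rw [hF.numBoundary_eq hB (fun _ => ⟨0, rfl⟩), Nat.card_unique]
    intro z w _
    rcases Int.even_or_odd (z - w) with hzw | hzw
    · exact eq_of_dvd_sub hstep hzw.two_dvd
    · rw [hR.untwisted w (hu w)]
      exact eq_of_dvd_sub hstep (by obtain ⟨k, hk⟩ := hzw; omega)
  · have hF : IsArcInvariant hn B fun z : ℤ => (z : ZMod 2) := by
      have hcast (z w : ℤ) (hzw : z % 2 = w % 2) : (z : ZMod 2) = w :=
        (ZMod.intCast_eq_intCast_iff z w 2).2 hzw
      exact ⟨fun z => hcast _ _ (by omega), fun z _ => hcast _ _ (by omega),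
        fun z hz => absurd hz (hu z), fun z hz => absurd hz (hu z)⟩
    rw [hF.numBoundary_eq hB (ZMod.intCast_surjective), Nat.card_zmod]
    intro z w hzw
    refine eq_of_dvd_sub hstep ?_
    have := (ZMod.intCast_eq_intCast_iff z w 2).1 hzw
    exact (Int.ModEq.dvd this.symm)

/-- The Euler genus of a complete bouquet in terms of its number of untwisted chords. -/
theorem eulerGenus_of_interlaced (hn : 2 ≤ n) (B : Bouquet n E)
    (hB : ∀ e e' : E, e ≠ e' → B.Interlaced e e') :
    B.eulerGenus =
      if (Finset.univ.filter fun e => B.sign e = true).card = n then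
        (if n % 2 = 0 then n else n - 1)
      else (Finset.univ.filter fun e => B.sign e = true).card + 1 := by
  have hcard := Finset.card_filter_add_card_filter_not (s := (Finset.univ : Finset E))
    (fun e => B.sign e = true)
  simp only [Bool.not_eq_true, Finset.card_univ, B.card_chords] at hcard
  by_cases h : ∀ e, B.sign e = true
  · rw [eulerGenus, numBoundary_of_untwisted hn B hB h]
    simp only [h, Finset.filter_true, Finset.card_univ, B.card_chords, if_true]
    split_ifs <;> omega
  · push Not at h
    obtain ⟨e, he⟩ := h
    replace he : B.sign e = false := by simpa using he
    rw [eulerGenus, numBoundary_of_twisted hn B hB he]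
    have hpos : 0 < (Finset.univ.filter fun e => B.sign e = false).card :=
      Finset.card_pos.2 ⟨e, by simp [he]⟩
    rw [if_neg (by omega)]
    omega

theorem filter_petrial_sign (B : Bouquet n E) (A : Finset E) :
    (Finset.univ.filter fun e => (B.petrial A).sign e = true) =
      symmDiff (Finset.univ.filter fun e => B.sign e = true) A := by
  ext e
  by_cases h : e ∈ A <;> simp [petrial, Finset.mem_symmDiff, h]

end Bouquet

/-- The partial Petrial polynomial of a bouquet on `n ≥ 2` chords whose intersection
graph is the complete graph `K_n`:
`z^n + Σ_{i=1}^n C(n, n+1-i) z^i` for even `n`, and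
`z^{n-1} + Σ_{i=1}^n C(n, n+1-i) z^i` for odd `n`. -/
theorem stmt12 {n : ℕ} (hn : 2 ≤ n) {E : Type} [Fintype E] [DecidableEq E]
    (B : Bouquet n E) (hcomplete : ∀ e e' : E, e ≠ e' → B.Interlaced e e') :
    B.petrialPoly =
      (if n % 2 = 0 then Polynomial.X ^ n else Polynomial.X ^ (n - 1)) +
        ∑ i ∈ Finset.Icc 1 n,
          Polynomial.C ((n.choose (n + 1 - i) : ℤ)) * Polynomial.X ^ i := by
  let g : ℕ → ℤ[X] := fun k => X ^ (if k = n then (if n % 2 = 0 then n else n - 1) else k + 1)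
  let S : Finset E := Finset.univ.filter fun e => B.sign e = true
  have h1 : B.petrialPoly = ∑ A : Finset E, g (symmDiff S A).card := by
    refine Finset.sum_congr rfl fun A _ => ?_
    rw [(B.petrial A).eulerGenus_of_interlaced hn hcomplete, B.filter_petrial_sign]
  have h2 : ∑ A : Finset E, g (symmDiff S A).card = ∑ U : Finset E, g U.card :=
    Equiv.sum_comp
      (Function.Involutive.toPerm (symmDiff S) fun A => symmDiff_symmDiff_cancel_left S A)
      fun U => g U.card
  have h3 : ∑ U : Finset E, g U.card = ∑ k ∈ Finset.range (n + 1), n.choose k • g k := by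
    rw [← Finset.powerset_univ, Finset.sum_powerset_apply_card, Finset.card_univ, B.card_chords]
  rw [h1, h2, h3, Finset.sum_range_succ, add_comm]
  congr 1
  · simp only [g, if_true, Nat.choose_self, one_smul]
    split_ifs <;> rfl
  · rw [← Finset.Ico_add_one_right_eq_Icc, Finset.sum_Ico_eq_sum_range, Nat.add_sub_cancel]
    refine Finset.sum_congr rfl fun k hk => ?_
    have hk' := Finset.mem_range.1 hk
    rw [show n + 1 - (1 + k) = n - k by omega, Nat.choose_symm hk'.le]
    simp [g, hk'.ne, add_comm]
end

section
/- Let B be a signed chord diagram on n ≥ 1 chords whose intersection graph I(B) is isomorphic to the path graph on n vertices. Then f(B) ∈ {1, 2}; equivalently, ε(B) ∈ {n−1, n}. -/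
open Finset Polynomial

namespace Bouquet

variable {n : ℕ} {E : Type} [Fintype E] [DecidableEq E]

lemma exists_endpoints (B : Bouquet n E) (e : E) :
    ∃ i j : Fin (2 * n), i < j ∧ ∀ k, B.chord k = e ↔ k = i ∨ k = j := by
  obtain ⟨i, j, hij, h⟩ := Finset.card_eq_two.mp (B.fiber_two e)
  have hmem : ∀ k, B.chord k = e ↔ k = i ∨ k = j := fun k => by
    simpa using Finset.ext_iff.mp h k
  rcases lt_or_gt_of_ne hij with hlt | hlt
  · exact ⟨i, j, hlt, hmem⟩
  · exact ⟨j, i, hlt, fun k => (hmem k).trans or_comm⟩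

lemma card_endpoints_between (B : Bouquet n E) {e : E} {k l : Fin (2 * n)} (hkl : k < l)
    (h : ∀ m, B.chord m = e ↔ m = k ∨ m = l) (i j : Fin (2 * n)) :
    (Finset.univ.filter fun m => B.chord m = e ∧ i < m ∧ m < j).card =
      (if i < k ∧ k < j then 1 else 0) + (if i < l ∧ l < j then 1 else 0) := by
  have hset : (Finset.univ.filter fun m => B.chord m = e ∧ i < m ∧ m < j) =
      ({k, l} : Finset (Fin (2 * n))).filter fun m => i < m ∧ m < j := by
    ext m
    simp [h]
  rw [hset, Finset.card_filter, Finset.sum_pair hkl.ne]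

lemma interlaced_iff (B : Bouquet n E) {e e' : E} {i j : Fin (2 * n)} (hij : i < j)
    (h : ∀ m, B.chord m = e ↔ m = i ∨ m = j) :
    B.Interlaced e e' ↔ e ≠ e' ∧
      (Finset.univ.filter fun m => B.chord m = e' ∧ i < m ∧ m < j).card = 1 := by
  refine ⟨?_, fun ⟨hne, hc⟩ => ⟨hne, i, j, (h i).2 (.inl rfl), (h j).2 (.inr rfl), hij, hc⟩⟩
  rintro ⟨hne, a, b, ha, hb, hab, hc⟩
  rw [h] at ha hb
  obtain ⟨rfl, rfl⟩ : a = i ∧ b = j := by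
    rcases ha with rfl | rfl <;> rcases hb with rfl | rfl
    · exact absurd hab (lt_irrefl _)
    · exact ⟨rfl, rfl⟩
    · exact absurd hab hij.not_gt
    · exact absurd hab (lt_irrefl _)
  exact ⟨hne, hc⟩

lemma Interlaced.symm {B : Bouquet n E} {e e' : E} (h : B.Interlaced e e') :
    B.Interlaced e' e := by
  obtain ⟨i, j, hij, he⟩ := B.exists_endpoints e
  obtain ⟨k, l, hkl, he'⟩ := B.exists_endpoints e'
  rw [B.interlaced_iff hij he, B.card_endpoints_between hkl he'] at h
  rw [B.interlaced_iff hkl he', B.card_endpoints_between hij he]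
  obtain ⟨hne, h⟩ := h
  refine ⟨hne.symm, ?_⟩
  have disjoint : ∀ a, (a = i ∨ a = j) → (a = k ∨ a = l) → False := fun a ha ha' =>
    hne (((he a).2 ha).symm.trans ((he' a).2 ha'))
  have h1 : i ≠ k := fun h => disjoint i (.inl rfl) (.inl h)
  have h2 : i ≠ l := fun h => disjoint i (.inl rfl) (.inr h)
  have h3 : j ≠ k := fun h => disjoint j (.inr rfl) (.inl h)
  have h4 : j ≠ l := fun h => disjoint j (.inr rfl) (.inr h)
  simp only [Fin.lt_def, ne_eq, Fin.ext_iff] at *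
  split_ifs at h ⊢ <;> omega

lemma intersectionGraph_adj (B : Bouquet n E) {e e' : E} :
    B.intersectionGraph.Adj e e' ↔ B.Interlaced e e' := by
  rw [intersectionGraph, SimpleGraph.fromRel_adj]
  exact ⟨fun h => h.2.elim id Interlaced.symm, fun h => ⟨h.1, .inl h⟩⟩

open Classical in
lemma cast_card_endpoints_between (B : Bouquet n E) {e : E} {i j : Fin (2 * n)} (hij : i < j)
    (h : ∀ m, B.chord m = e ↔ m = i ∨ m = j) (e' : E) :
    ((Finset.univ.filter fun m => B.chord m = e' ∧ i < m ∧ m < j).card : ZMod 2) =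
      if B.intersectionGraph.Adj e e' then 1 else 0 := by
  rw [intersectionGraph_adj, B.interlaced_iff hij h]
  by_cases hne : e = e'
  · subst hne
    simp [B.card_endpoints_between hij h]
  · obtain ⟨k, l, hkl, he'⟩ := B.exists_endpoints e'
    rw [B.card_endpoints_between hkl he']
    have two : (2 : ZMod 2) = 0 := rfl
    by_cases h1 : i < k ∧ k < j <;> by_cases h2 : i < l ∧ l < j <;> simp [h1, h2, hne]
    exact two

open Classical in
lemma sum_between (B : Bouquet n E) {e : E} {i j : Fin (2 * n)} (hij : i < j)
    (h : ∀ m, B.chord m = e ↔ m = i ∨ m = j) (y : E → ZMod 2) :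
    ∑ m ∈ Finset.Ioo i j, y (B.chord m) =
      ∑ e', if B.intersectionGraph.Adj e e' then y e' else 0 := by
  rw [← Finset.sum_fiberwise_of_maps_to (t := Finset.univ) (g := B.chord)
    (fun _ _ => Finset.mem_univ _)]
  refine Finset.sum_congr rfl fun e' _ => ?_
  rw [Finset.sum_congr rfl (g := fun _ => y e')
    (fun m hm => by rw [(Finset.mem_filter.mp hm).2]), Finset.sum_const, nsmul_eq_mul]
  have hset : (Finset.Ioo i j).filter (fun m => B.chord m = e') =
      Finset.univ.filter fun m => B.chord m = e' ∧ i < m ∧ m < j := by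
    ext m
    simp [and_comm]
  rw [hset, B.cast_card_endpoints_between hij h, ite_mul, one_mul, zero_mul]

lemma sum_Ioo_jump {N : ℕ} (g : Fin N × Bool → ZMod 2)
    (hg : ∀ a b : Fin N, b.val = a.val + 1 → g (a, true) = g (b, false)) {i j : Fin N}
    (hij : i < j) :
    ∑ m ∈ Finset.Ioo i j, (g (m, true) + g (m, false)) = g (j, false) + g (i, true) := by
  obtain ⟨d, hd⟩ : ∃ d, j.val = i.val + 1 + d := ⟨j.val - i.val - 1, by
    rw [Fin.lt_def] at hij; omega⟩
  clear hij
  induction d generalizing j with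
  | zero =>
    have hempty : Finset.Ioo i j = ∅ := by
      ext m
      simp only [Finset.mem_Ioo, Fin.lt_def, Finset.notMem_empty, iff_false]
      omega
    rw [hempty, Finset.sum_empty, hg i j (by omega), CharTwo.add_self_eq_zero]
  | succ d ih =>
    let j' : Fin N := ⟨i.val + 1 + d, by omega⟩
    have hinsert : Finset.Ioo i j = insert j' (Finset.Ioo i j') := by
      ext m
      simp only [Finset.mem_Ioo, Finset.mem_insert, Fin.lt_def, Fin.ext_iff, j']
      omega
    rw [hinsert, Finset.sum_insert (by simp), ih rfl, hg j' j (by simp [j']; omega)]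
    linear_combination CharTwo.add_self_eq_zero (g (j', false))

lemma apply_true_eq_of_succ (B : Bouquet n E) {g : Fin (2 * n) × Bool → ZMod 2}
    (hg : ∀ x y, B.boundaryGraph.Adj x y → g x = g y) (a b : Fin (2 * n))
    (hab : b.val = a.val + 1) : g (a, true) = g (b, false) := by
  refine hg _ _ ?_
  rw [boundaryGraph, SimpleGraph.fromRel_adj]
  refine ⟨by simp, .inl (.inl ⟨rfl, rfl, ?_⟩)⟩
  rw [Nat.mod_eq_of_lt (hab ▸ b.isLt)]
  exact hab

lemma apply_eq_of_chord_eq (B : Bouquet n E) {g : Fin (2 * n) × Bool → ZMod 2}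
    (hg : ∀ x y, B.boundaryGraph.Adj x y → g x = g y) {a b : Fin (2 * n)}
    (hab : B.chord a = B.chord b) (hne : a ≠ b) (c : Bool) :
    g (a, c) = g (b, if B.sign (B.chord a) then !c else c) := by
  refine hg _ _ ?_
  rw [boundaryGraph, SimpleGraph.fromRel_adj]
  refine ⟨by simp [hne], .inl (.inr ⟨hab, hne, ?_⟩)⟩
  cases B.sign (B.chord a) <;> simp

open Classical in
lemma exists_radical_vector (B : Bouquet n E) {g : Fin (2 * n) × Bool → ZMod 2}
    (hg : ∀ x y, B.boundaryGraph.Adj x y → g x = g y) :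
    ∃ y : E → ZMod 2, (∀ m, y (B.chord m) = g (m, true) + g (m, false)) ∧
      ∀ e, (if B.sign e then 0 else 1) * y e +
        (∑ e', if B.intersectionGraph.Adj e e' then y e' else 0) = 0 := by
  choose p q hpq hmem using B.exists_endpoints
  let y : E → ZMod 2 := fun e => g (p e, true) + g (p e, false)
  have hy : ∀ m, y (B.chord m) = g (m, true) + g (m, false) := by
    intro m
    have hp : B.chord (p (B.chord m)) = B.chord m := (hmem _ _).2 (.inl rfl)
    by_cases hne : p (B.chord m) = m
    · simp only [y, hne]
    · simp only [y, B.apply_eq_of_chord_eq hg hp hne]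
      cases B.sign (B.chord (p (B.chord m)))
      · simp
      · simp [add_comm]
  refine ⟨y, hy, fun e => ?_⟩
  have hp : B.chord (p e) = e := (hmem _ _).2 (.inl rfl)
  have hq : B.chord (q e) = e := (hmem _ _).2 (.inr rfl)
  rw [← B.sum_between (hpq e) (hmem e) y, Finset.sum_congr rfl fun m _ => hy m,
    sum_Ioo_jump g (B.apply_true_eq_of_succ hg) (hpq e),
    B.apply_eq_of_chord_eq hg (hp.trans hq.symm) (hpq e).ne true, hp]
  have hye : y e = g (q e, true) + g (q e, false) := by rw [← hy, hq]
  rw [hye]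
  cases B.sign e
  · simp only [Bool.false_eq_true, if_false]
    linear_combination CharTwo.add_self_eq_zero (g (q e, true)) +
      CharTwo.add_self_eq_zero (g (q e, false))
  · simp [CharTwo.add_self_eq_zero]

lemma eq_zero_of_jump_eq_zero (B : Bouquet n E) {g : Fin (2 * n) × Bool → ZMod 2}
    (hg : ∀ x y, B.boundaryGraph.Adj x y → g x = g y) (hpos : 0 < 2 * n)
    (h0 : g (⟨0, hpos⟩, false) = 0) (hjump : ∀ m, g (m, true) + g (m, false) = 0) : g = 0 := by
  have htrue : ∀ m, g (m, true) = g (m, false) := fun m => CharTwo.add_eq_zero.mp (hjump m)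
  have hfalse : ∀ k (hk : k < 2 * n), g (⟨k, hk⟩, false) = 0 := by
    intro k
    induction k with
    | zero => exact fun _ => h0
    | succ k ih =>
      intro hk
      rw [← B.apply_true_eq_of_succ hg ⟨k, by omega⟩ ⟨k + 1, hk⟩ rfl, htrue, ih]
  funext ⟨m, c⟩
  cases c
  · exact hfalse m m.isLt
  · exact (htrue m).trans (hfalse m m.isLt)

open Classical in
lemma eq_zero_of_pathGraph_kernel {R : Type*} [NonAssocSemiring R] {n : ℕ} (hn : 0 < n)
    (c z : Fin n → R)
    (hz : ∀ k, c k * z k + (∑ m, if (SimpleGraph.pathGraph n).Adj k m then z m else 0) = 0)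
    (h0 : z ⟨0, hn⟩ = 0) : z = 0 := by
  have key : ∀ k (hk : k < n), z ⟨k, hk⟩ = 0 := by
    intro k
    induction k using Nat.strong_induction_on with
    | _ k ih =>
      intro hk
      rcases k with _ | k
      · exact h0
      · have hrow := hz ⟨k, by omega⟩
        rw [ih k (by omega), mul_zero, zero_add,
          Finset.sum_eq_single_of_mem ⟨k + 1, hk⟩ (Finset.mem_univ _)] at hrow
        · simpa [SimpleGraph.pathGraph_adj] using hrow
        · intro m _ hm
          rw [ite_eq_right_iff, SimpleGraph.pathGraph_adj]
          rintro (h | h)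
          · exact absurd (Fin.ext h.symm) hm
          · exact ih m (by simp at h; omega) m.isLt
  exact funext fun k => key k k.isLt

lemma eq_zero_of_pathGraph (hn : 0 < n) (B : Bouquet n E)
    (φ : B.intersectionGraph ≃g SimpleGraph.pathGraph n) {g : Fin (2 * n) × Bool → ZMod 2}
    (hg : ∀ x y, B.boundaryGraph.Adj x y → g x = g y) {hpos : 0 < 2 * n}
    (h0 : g (⟨0, hpos⟩, false) = 0) {i : Fin (2 * n)}
    (hi : B.chord i = φ.symm ⟨0, hn⟩) (hjump : g (i, true) + g (i, false) = 0) : g = 0 := by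
  classical
  obtain ⟨y, hy, hker⟩ := B.exists_radical_vector hg
  have hz : (fun k => y (φ.symm k)) = 0 := by
    refine eq_zero_of_pathGraph_kernel hn
      (fun k => if B.sign (φ.symm k) then 0 else 1) _ (fun k => ?_) ?_
    · refine Eq.trans ?_ (hker (φ.symm k))
      congr 1
      refine Fintype.sum_equiv φ.symm.toEquiv _ _ fun m => ?_
      simp only [RelIso.coe_fn_toEquiv, SimpleGraph.Iso.map_adj_iff]
    · rw [← hi, hy, hjump]
  refine B.eq_zero_of_jump_eq_zero hg hpos h0 fun m => ?_
  rw [← hy]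
  simpa using congrFun hz (φ (B.chord m))

lemma numBoundary_le_two (hn : 0 < n) (B : Bouquet n E)
    (φ : B.intersectionGraph ≃g SimpleGraph.pathGraph n) : B.numBoundary ≤ 2 := by
  classical
  have hpos : 0 < 2 * n := by omega
  obtain ⟨i, _, _, hmem⟩ := B.exists_endpoints (φ.symm ⟨0, hn⟩)
  have hi : B.chord i = φ.symm ⟨0, hn⟩ := (hmem i).2 (.inl rfl)
  let ev : (B.boundaryGraph.ConnectedComponent → ZMod 2) → ZMod 2 × ZMod 2 := fun w =>
    (w (B.boundaryGraph.connectedComponentMk (⟨0, hpos⟩, false)),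
      w (B.boundaryGraph.connectedComponentMk (i, true)) +
        w (B.boundaryGraph.connectedComponentMk (i, false)))
  have hinj : Function.Injective ev := by
    intro w w' hww
    obtain ⟨h1, h2⟩ := Prod.mk.inj hww
    have hzero := B.eq_zero_of_pathGraph hn φ
      (g := fun x => w (B.boundaryGraph.connectedComponentMk x) -
        w' (B.boundaryGraph.connectedComponentMk x))
      (fun x y hxy => by
        simp only [SimpleGraph.ConnectedComponent.connectedComponentMk_eq_of_adj hxy])
      (hpos := hpos) (sub_eq_zero.mpr h1) hi (by linear_combination h2)
    funext C
    induction C using SimpleGraph.ConnectedComponent.ind with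
    | _ v => exact sub_eq_zero.mp (congrFun hzero v)
  have hcard := Nat.card_le_card_of_injective ev hinj
  rw [Nat.card_fun, Nat.card_prod, Nat.card_zmod] at hcard
  exact (Nat.pow_le_pow_iff_right (a := 2) (by norm_num)).mp hcard

lemma numBoundary_pos (hn : 0 < n) (B : Bouquet n E) : 0 < B.numBoundary := by
  have : Nonempty B.boundaryGraph.ConnectedComponent :=
    ⟨B.boundaryGraph.connectedComponentMk (⟨0, by omega⟩, false)⟩
  exact Nat.card_pos

end Bouquet

/-- A bouquet on `n ≥ 1` chords whose intersection graph is (isomorphic to) the path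
graph on `n` vertices has one or two boundary components; equivalently its Euler genus
is `n-1` or `n`. -/
theorem stmt13 {n : ℕ} (hn : 1 ≤ n) {E : Type} [Fintype E] [DecidableEq E]
    (B : Bouquet n E) (hiso : Nonempty (B.intersectionGraph ≃g SimpleGraph.pathGraph n)) :
    (B.numBoundary = 1 ∨ B.numBoundary = 2) ∧
    (B.eulerGenus = n - 1 ∨ B.eulerGenus = n) := by
  obtain ⟨φ⟩ := hiso
  have hle := B.numBoundary_le_two hn φ
  have hpos := B.numBoundary_pos hn
  unfold Bouquet.eulerGenus
  omega
end

section
/- Let B be a signed chord diagram on n ≥ 2 chords, and suppose some chord e has its two endpoints at consecutive positions p and p+1 of Z/2nZ and has sign s(e) = −1. Let B′ be the signed chord diagram on n − 1 chords obtained from B by deleting the chord e (removing positions p and p+1 and renumbering the remaining 2n − 2 positions cyclically, keeping all other chords and signs). Then f(B′) = f(B). -/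
open Finset Polynomial

namespace SimpleGraph

variable {V W : Type*} {G : SimpleGraph V} {H : SimpleGraph W}

theorem Reachable.map_of_adj {f : V → W} (hf : ∀ a b, G.Adj a b → H.Reachable (f a) (f b))
    {a b : V} (h : G.Reachable a b) : H.Reachable (f a) (f b) := by
  obtain ⟨w⟩ := h
  induction w with
  | nil => exact Reachable.refl _
  | cons hadj _ ih => exact (hf _ _ hadj).trans ih

theorem card_connectedComponent_eq_of_retraction {f : V → W} {g : W → V}
    (hf : ∀ a b, G.Adj a b → H.Reachable (f a) (f b))
    (hg : ∀ a b, H.Adj a b → G.Reachable (g a) (g b))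
    (hgf : ∀ a, G.Reachable (g (f a)) a) (hfg : ∀ b, H.Reachable (f (g b)) b) :
    Nat.card G.ConnectedComponent = Nat.card H.ConnectedComponent :=
  Nat.card_congr
    { toFun := Quot.map f fun _ _ h => h.map_of_adj hf
      invFun := Quot.map g fun _ _ h => h.map_of_adj hg
      left_inv := by
        rintro ⟨a⟩
        exact Quot.sound (hgf a)
      right_inv := by
        rintro ⟨b⟩
        exact Quot.sound (hfg b) }

theorem reachable_fromRel {r : V → V → Prop} {a b : V} (h : r a b) :
    (SimpleGraph.fromRel r).Reachable a b := by
  by_cases hab : a = b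
  · exact hab ▸ Reachable.refl _
  · exact Adj.reachable ((fromRel_adj r a b).2 ⟨hab, Or.inl h⟩)

theorem reachable_of_fromRel_adj {r : V → V → Prop} {f : V → W}
    (hf : ∀ a b, r a b → H.Reachable (f a) (f b)) (a b : V) (h : (fromRel r).Adj a b) :
    H.Reachable (f a) (f b) := by
  obtain ⟨-, h | h⟩ := (fromRel_adj r a b).1 h
  · exact hf a b h
  · exact (hf b a h).symm

end SimpleGraph

namespace Bouquet

section Positions

variable {m : ℕ}

/-- The position `k` steps after `p` on the circle of `m` positions. -/
def shift (p : Fin m) (k : ℕ) : Fin m :=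
  ⟨(p.val + k) % m, Nat.mod_lt _ (Nat.zero_lt_of_lt p.isLt)⟩

/-- The number of steps from `p` to `i` on the circle of `m` positions. -/
def offset (p i : Fin m) : ℕ :=
  if p.val ≤ i.val then i.val - p.val else i.val + m - p.val

theorem offset_lt (p i : Fin m) : offset p i < m := by
  unfold offset
  split_ifs <;> omega

theorem shift_offset (p i : Fin m) : shift p (offset p i) = i := by
  apply Fin.ext
  unfold shift offset
  split_ifs with h
  · simp only [Nat.add_sub_cancel' h, Nat.mod_eq_of_lt i.isLt]
  · have : p.val + (i.val + m - p.val) = i.val + m := by omega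
    simp only [this, Nat.add_mod_right, Nat.mod_eq_of_lt i.isLt]

theorem offset_shift (p : Fin m) {k : ℕ} (hk : k < m) : offset p (shift p k) = k := by
  unfold shift offset
  rcases lt_or_ge (p.val + k) m with h | h
  · simp only [Nat.mod_eq_of_lt h]
    split_ifs <;> omega
  · simp only [Nat.mod_eq_sub_mod h, Nat.mod_eq_of_lt (show p.val + k - m < m by omega)]
    split_ifs <;> omega

theorem shift_zero (p : Fin m) : shift p 0 = p :=
  Fin.ext (Nat.mod_eq_of_lt p.isLt)

theorem shift_self (p : Fin m) : shift p m = p :=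
  Fin.ext ((Nat.add_mod_right _ _).trans (Nat.mod_eq_of_lt p.isLt))

theorem shift_succ_val (p : Fin m) (k : ℕ) :
    (shift p (k + 1)).val = ((shift p k).val + 1) % m := by
  simp [shift, ← add_assoc]

end Positions

variable {n : ℕ} {E : Type} [Fintype E] [DecidableEq E]

theorem reachable_shift_succ (B : Bouquet n E) (p : Fin (2 * n)) (k : ℕ) :
    B.boundaryGraph.Reachable (shift p k, true) (shift p (k + 1), false) :=
  SimpleGraph.reachable_fromRel (Or.inl ⟨rfl, rfl, shift_succ_val p k⟩)

theorem reachable_of_chord_eq (B : Bouquet n E) {x y : Fin (2 * n) × Bool}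
    (h : B.chord x.1 = B.chord y.1) (hne : x.1 ≠ y.1)
    (hs : if B.sign (B.chord x.1) then x.2 ≠ y.2 else x.2 = y.2) :
    B.boundaryGraph.Reachable x y :=
  SimpleGraph.reachable_fromRel (Or.inr ⟨h, hne, hs⟩)

/-- All four points of a twisted chord with consecutive endpoints lie on the boundary
component of the point that follows them. -/
theorem reachable_of_twisted_consecutive (B : Bouquet n E) (hn : 2 ≤ n) {p : Fin (2 * n)}
    (h : B.chord (shift p 1) = B.chord p) (hs : B.sign (B.chord p) = false)
    {k : ℕ} (hk : k < 2) (b : Bool) :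
    B.boundaryGraph.Reachable (shift p 2, false) (shift p k, b) := by
  have hne : p ≠ shift p 1 := fun h => by
    have := congrArg (offset p) h
    rw [offset_shift p (by omega)] at this
    simp [offset] at this
  have hτ (b : Bool) : B.boundaryGraph.Reachable (p, b) (shift p 1, b) :=
    B.reachable_of_chord_eq h.symm hne (by simp [hs])
  have hσ₀ := B.reachable_shift_succ p 0
  have hσ₁ := B.reachable_shift_succ p 1
  rw [shift_zero] at hσ₀
  have h₁ := hσ₁.symm
  have h₀ := h₁.trans (hτ true).symm
  have h₁' := h₀.trans hσ₀
  have h₀' := h₁'.trans (hτ false).symm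
  interval_cases k <;> cases b <;> first | assumption | (rw [shift_zero]; assumption)

end Bouquet

open Bouquet in
/-- Operation 4: deleting a twisted chord whose endpoints are at consecutive positions
`p`, `p+1` (and renumbering the remaining positions cyclically) does not change the
number of boundary components. -/
theorem stmt17 {n : ℕ} (hn : 2 ≤ n) {E : Type} [Fintype E] [DecidableEq E]
    (B : Bouquet n E) (e : E) (p : Fin (2 * n))
    (hp : B.chord p = e)
    (hp1 : B.chord ⟨(p.val + 1) % (2 * n), Nat.mod_lt _ (by omega)⟩ = e)
    (hsign : B.sign e = false)
    (B' : Bouquet (n - 1) {x : E // x ≠ e})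
    (hchord : ∀ q : Fin (2 * (n - 1)),
      (B'.chord q : E) =
        B.chord ⟨(p.val + 2 + q.val) % (2 * n), Nat.mod_lt _ (by omega)⟩)
    (hsign' : ∀ x : {x : E // x ≠ e}, B'.sign x = B.sign x) :
    B'.numBoundary = B.numBoundary := by
  have hkill (k : ℕ) (hk : k < 2) (b : Bool) :
      B.boundaryGraph.Reachable (shift p 2, false) (shift p k, b) :=
    B.reachable_of_twisted_consecutive hn (hp1.trans hp.symm) (hp ▸ hsign) hk b
  have hchord' (q : Fin (2 * (n - 1))) : (B'.chord q : E) = B.chord (shift p (q.val + 2)) := by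
    rw [hchord]
    simp only [shift, add_assoc, add_comm 2]
  have hdead (k : ℕ) (hk : k < 2) : B.chord (shift p k) = e := by
    interval_cases k
    · rwa [shift_zero]
    · exact hp1
  let f : Fin (2 * (n - 1)) × Bool → Fin (2 * n) × Bool := fun x => (shift p (x.1.val + 2), x.2)
  let g : Fin (2 * n) × Bool → Fin (2 * (n - 1)) × Bool := fun x =>
    if 2 ≤ offset p x.1 then
      (⟨offset p x.1 - 2, by have := offset_lt p x.1; omega⟩, x.2)
    else (⟨0, by omega⟩, false)
  have g_live (k : ℕ) (hk : k < 2 * (n - 1)) (b : Bool) :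
      g (shift p (k + 2), b) = (⟨k, hk⟩, b) := by
    simp [g, offset_shift p (show k + 2 < 2 * n by omega)]
  have g_dead (k : ℕ) (hk : k < 2) (b : Bool) :
      g (shift p k, b) = (⟨0, by omega⟩, false) := by
    simp [g, offset_shift p (show k < 2 * n by omega), hk]
  have live_ne (k : ℕ) (hk : k < 2 * (n - 1)) : B.chord (shift p (k + 2)) ≠ e :=
    hchord' ⟨k, hk⟩ ▸ (B'.chord ⟨k, hk⟩).2
  have cover (i : Fin (2 * n)) :
      (∃ k, k < 2 ∧ i = shift p k) ∨ ∃ k, k < 2 * (n - 1) ∧ i = shift p (k + 2) := by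
    have hlt := offset_lt p i
    rcases lt_or_ge (offset p i) 2 with h | h
    · exact Or.inl ⟨_, h, (shift_offset p i).symm⟩
    · refine Or.inr ⟨offset p i - 2, by omega, ?_⟩
      rw [Nat.sub_add_cancel h, shift_offset]
  have shift_inj {k l : ℕ} (hk : k < 2 * n) (hl : l < 2 * n) (h : shift p k = shift p l) :
      k = l := by
    rw [← offset_shift p hk, h, offset_shift p hl]
  refine SimpleGraph.card_connectedComponent_eq_of_retraction (f := f) (g := g)
    (SimpleGraph.reachable_of_fromRel_adj ?_) (SimpleGraph.reachable_of_fromRel_adj ?_) ?_ ?_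
  · rintro ⟨q, b⟩ ⟨q', b'⟩ (⟨hb, hb', hq⟩ | ⟨hc, hne, hs⟩)
    · dsimp only at hb hb' hq
      subst hb hb'
      have hσ := B.reachable_shift_succ p (q.val + 2)
      rcases lt_or_ge (q.val + 1) (2 * (n - 1)) with h | h
      · rw [Nat.mod_eq_of_lt h] at hq
        simpa [f, hq, add_right_comm] using hσ
      · have h1 : q.val + 1 = 2 * (n - 1) := by omega
        have h2 : q.val + 2 + 1 = 2 * n := by omega
        rw [h1, Nat.mod_self] at hq
        rw [h2, shift_self, ← shift_zero p] at hσ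
        simpa [f, hq, shift_zero] using hσ.trans (hkill 0 (by omega) false).symm
    · refine B.reachable_of_chord_eq ?_ ?_ ?_
      · simpa only [f, hchord'] using congrArg Subtype.val hc
      · intro h
        have := shift_inj (by omega) (by omega) h
        exact hne (Fin.ext (by simpa using this))
      · simpa only [f, hsign', hchord'] using hs
  · rintro ⟨i, b⟩ ⟨j, b'⟩ (⟨hb, hb', hij⟩ | ⟨hc, hne, hs⟩)
    · dsimp only at hb hb' hij
      subst hb hb'
      rcases cover i with ⟨k, hk, rfl⟩ | ⟨k, hk, rfl⟩
      · obtain rfl : j = shift p (k + 1) := Fin.ext (hij.trans (shift_succ_val p k).symm)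
        rw [g_dead k hk]
        interval_cases k
        · rw [g_dead _ (by omega)]
        · rw [g_live 0 (by omega)]
      · obtain rfl : j = shift p (k + 2 + 1) := Fin.ext (hij.trans (shift_succ_val p _).symm)
        rw [g_live k hk]
        refine SimpleGraph.reachable_fromRel (Or.inl ⟨rfl, ?_⟩)
        rcases lt_or_ge (k + 1) (2 * (n - 1)) with h | h
        · rw [add_right_comm, g_live (k + 1) h]
          exact ⟨rfl, (Nat.mod_eq_of_lt h).symm⟩
        · have h1 : k + 1 = 2 * (n - 1) := by omega
          rw [show k + 2 + 1 = 2 * n by omega, shift_self, ← shift_zero p, g_dead 0 (by omega)]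
          simp [h1]
    · dsimp only at hc hne hs
      rcases cover i with ⟨k, hk, rfl⟩ | ⟨k, hk, rfl⟩ <;>
        rcases cover j with ⟨l, hl, rfl⟩ | ⟨l, hl, rfl⟩
      · rw [g_dead k hk, g_dead l hl]
      · exact absurd (hc.symm.trans (hdead k hk)) (live_ne l hl)
      · exact absurd (hc.trans (hdead l hl)) (live_ne k hk)
      · rw [g_live k hk, g_live l hl]
        refine B'.reachable_of_chord_eq (Subtype.ext ?_) ?_ ?_
        · simpa only [hchord'] using hc
        · intro h
          obtain rfl : k = l := congrArg Fin.val h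
          exact hne rfl
        · simpa only [hsign', hchord'] using hs
  · rintro ⟨q, b⟩
    rw [show g (f (q, b)) = (q, b) from g_live q.val q.isLt b]
  · rintro ⟨i, b⟩
    rcases cover i with ⟨k, hk, rfl⟩ | ⟨k, hk, rfl⟩
    · rw [g_dead k hk]
      exact hkill k hk b
    · rw [g_live k hk]
end

section
/- Let B be a signed chord diagram on n ≥ 3 chords, and suppose there are chords a and b and a position p ∈ Z/2nZ such that a has endpoints {p, p+2}, b has endpoints {p+1, p+3}, and s(a) = s(b) = +1. Let B′ be the signed chord diagram on n − 2 chords obtained from B by deleting the chords a and b (removing positions p, p+1, p+2, p+3 and renumbering the remaining 2n − 4 positions cyclically, keeping all other chords and signs). Then f(B′) = f(B). -/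
open Finset Polynomial

/-- A map sending edges into connected components preserves reachability. -/
theorem SimpleGraph.Reachable.map_of_adj_s18 {V W : Type*} {G : SimpleGraph V} {H : SimpleGraph W}
    {x y : V} (h : G.Reachable x y) (f : V → W)
    (hf : ∀ x y, G.Adj x y → H.Reachable (f x) (f y)) : H.Reachable (f x) (f y) := by
  obtain ⟨w⟩ := h
  induction w with
  | nil => exact SimpleGraph.Reachable.refl _
  | cons hadj _ ih => exact (hf _ _ hadj).trans ih

/-- Two graphs have equally many connected components as soon as there are maps in both
directions that send edges into components and are mutually inverse up to reachability. -/
theorem SimpleGraph.card_connectedComponent_eq_of_maps {V W : Type*} {G : SimpleGraph V}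
    {H : SimpleGraph W} (f : V → W) (g : W → V)
    (hf : ∀ x y, G.Adj x y → H.Reachable (f x) (f y))
    (hg : ∀ x y, H.Adj x y → G.Reachable (g x) (g y))
    (hgf : ∀ x, G.Reachable (g (f x)) x) (hfg : ∀ y, H.Reachable (f (g y)) y) :
    Nat.card G.ConnectedComponent = Nat.card H.ConnectedComponent := by
  refine Nat.card_congr
    { toFun := Quot.map f fun _ _ h => h.map_of_adj_s18 f hf
      invFun := Quot.map g fun _ _ h => h.map_of_adj_s18 g hg
      left_inv := ?_
      right_inv := ?_ }
  · rintro ⟨x⟩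
    exact Quot.sound (hgf x)
  · rintro ⟨y⟩
    exact Quot.sound (hfg y)

theorem Nat.mod_eq_ite_of_lt_add {k m : ℕ} (h : k < m + m) :
    k % m = if k < m then k else k - m := by
  split_ifs with hk
  · exact Nat.mod_eq_of_lt hk
  · rw [Nat.mod_eq_sub_mod (by omega), Nat.mod_eq_of_lt (by omega)]

namespace Bouquet

variable {n : ℕ} {E : Type} [Fintype E] [DecidableEq E]

theorem boundaryGraph_adj_succ (B : Bouquet n E) {i j : Fin (2 * n)}
    (h : j.val = (i.val + 1) % (2 * n)) : B.boundaryGraph.Adj (i, true) (j, false) := by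
  simp [boundaryGraph, h]

theorem boundaryGraph_adj_chord (B : Bouquet n E) {i j : Fin (2 * n)} {s t : Bool}
    (h : B.chord i = B.chord j) (hij : i ≠ j)
    (hst : if B.sign (B.chord i) then s ≠ t else s = t) :
    B.boundaryGraph.Adj (i, s) (j, t) := by
  rw [boundaryGraph, SimpleGraph.fromRel_adj]
  exact ⟨fun e => hij (Prod.ext_iff.1 e).1, Or.inl (Or.inr ⟨h, hij, hst⟩)⟩

/-- To map the boundary graph into the components of another graph it suffices to treat the
edges of the two matchings separately. -/
theorem reachable_of_boundaryGraph_adj (B : Bouquet n E) {W : Type*} {H : SimpleGraph W}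
    (f : Fin (2 * n) × Bool → W)
    (hsucc : ∀ i j : Fin (2 * n), j.val = (i.val + 1) % (2 * n) →
      H.Reachable (f (i, true)) (f (j, false)))
    (hchord : ∀ (i j : Fin (2 * n)) (s t : Bool), B.chord i = B.chord j → i ≠ j →
      (if B.sign (B.chord i) then s ≠ t else s = t) → H.Reachable (f (i, s)) (f (j, t)))
    (x y : Fin (2 * n) × Bool) (h : B.boundaryGraph.Adj x y) : H.Reachable (f x) (f y) := by
  obtain ⟨i, s⟩ := x
  obtain ⟨j, t⟩ := y
  rw [boundaryGraph, SimpleGraph.fromRel_adj] at h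
  obtain ⟨-, (⟨hs, ht, hij⟩ | ⟨hc, hij, hst⟩) | (⟨hs, ht, hij⟩ | ⟨hc, hij, hst⟩)⟩ := h
  · obtain rfl : s = true := hs
    obtain rfl : t = false := ht
    exact hsucc i j hij
  · exact hchord i j s t hc hij hst
  · obtain rfl : t = true := hs
    obtain rfl : s = false := ht
    exact (hsucc j i hij).symm
  · exact (hchord j i t s hc hij hst).symm

/-- The position reached from `p` after `k` steps around the circle. -/
def rotate (p : Fin (2 * n)) (k : ℕ) : Fin (2 * n) :=
  ⟨(p.val + k) % (2 * n), Nat.mod_lt _ (Nat.zero_lt_of_lt p.isLt)⟩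

theorem exists_rotate_eq (p i : Fin (2 * n)) : ∃ k < 2 * n, rotate p k = i := by
  have hp := p.isLt
  have hi := i.isLt
  by_cases h : p.val ≤ i.val
  · refine ⟨i.val - p.val, by omega, Fin.ext ?_⟩
    simp only [rotate]
    rw [Nat.mod_eq_of_lt (by omega)]
    omega
  · refine ⟨i.val + 2 * n - p.val, by omega, Fin.ext ?_⟩
    simp only [rotate]
    rw [Nat.mod_eq_ite_of_lt_add (by omega)]
    split_ifs <;> omega

theorem rotate_injOn (p : Fin (2 * n)) {k l : ℕ} (hk : k < 2 * n) (hl : l < 2 * n)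
    (h : rotate p k = rotate p l) : k = l := by
  have hp := p.isLt
  have h' := congrArg Fin.val h
  simp only [rotate] at h'
  rw [Nat.mod_eq_ite_of_lt_add (by omega), Nat.mod_eq_ite_of_lt_add (by omega)] at h'
  split_ifs at h' <;> omega

theorem rotate_val_succ (p : Fin (2 * n)) (k : ℕ) :
    (rotate p (k + 1)).val = ((rotate p k).val + 1) % (2 * n) := by
  simp [rotate, Nat.add_assoc]

theorem rotate_length (p : Fin (2 * n)) : rotate p (2 * n) = rotate p 0 := by
  simp [rotate]

/-- The retraction of the points of a diagram onto those of the diagram with the four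
positions from `p` on removed: the points at the removed positions go to the outgoing point
of the last position. -/
noncomputable def retract (p : Fin (2 * n)) (hn : 3 ≤ n) (x : Fin (2 * n) × Bool) :
    Fin (2 * (n - 2)) × Bool :=
  let k := (exists_rotate_eq p x.1).choose
  if 4 ≤ k then (⟨k - 4, by
    have : k < 2 * n := (exists_rotate_eq p x.1).choose_spec.1
    omega⟩, x.2)
  else (⟨2 * n - 5, by omega⟩, true)

theorem retract_rotate (p : Fin (2 * n)) (hn : 3 ≤ n) {k : ℕ} (hk : k < 2 * n) (s : Bool) :
    retract p hn (rotate p k, s) =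
      if 4 ≤ k then (⟨k - 4, by omega⟩, s) else (⟨2 * n - 5, by omega⟩, true) := by
  have hc := (exists_rotate_eq p (rotate p k)).choose_spec
  have hkc := rotate_injOn p hc.1 hk hc.2
  simp only [retract, hkc]

end Bouquet

/-- Operation 3: deleting a pair of untwisted chords `a`, `b` occupying four consecutive
positions in the interlaced pattern `a b a b` (and renumbering the remaining positions
cyclically) does not change the number of boundary components. -/
theorem stmt18 {n : ℕ} (hn : 3 ≤ n) {E : Type} [Fintype E] [DecidableEq E]
    (B : Bouquet n E) (a b : E) (hab : a ≠ b) (p : Fin (2 * n))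
    (hpa : B.chord p = a)
    (hpa2 : B.chord ⟨(p.val + 2) % (2 * n), Nat.mod_lt _ (by omega)⟩ = a)
    (hpb1 : B.chord ⟨(p.val + 1) % (2 * n), Nat.mod_lt _ (by omega)⟩ = b)
    (hpb3 : B.chord ⟨(p.val + 3) % (2 * n), Nat.mod_lt _ (by omega)⟩ = b)
    (hsa : B.sign a = true) (hsb : B.sign b = true)
    (B' : Bouquet (n - 2) {x : E // x ≠ a ∧ x ≠ b})
    (hchord : ∀ q : Fin (2 * (n - 2)),
      (B'.chord q : E) =
        B.chord ⟨(p.val + 4 + q.val) % (2 * n), Nat.mod_lt _ (by omega)⟩)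
    (hsign' : ∀ x : {x : E // x ≠ a ∧ x ≠ b}, B'.sign x = B.sign x) :
    B'.numBoundary = B.numBoundary := by
  have rot_ne {k l : ℕ} (hk : k < 2 * n) (hl : l < 2 * n) (hkl : k ≠ l) :
      Bouquet.rotate p k ≠ Bouquet.rotate p l := fun h => hkl (Bouquet.rotate_injOn p hk hl h)
  have c0 : B.chord (Bouquet.rotate p 0) = a := by
    have : Bouquet.rotate p 0 = p := Fin.ext (by simp [Bouquet.rotate, Nat.mod_eq_of_lt p.isLt])
    rw [this, hpa]
  have c1 : B.chord (Bouquet.rotate p 1) = b := hpb1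
  have c2 : B.chord (Bouquet.rotate p 2) = a := hpa2
  have c3 : B.chord (Bouquet.rotate p 3) = b := hpb3
  have cq (q : Fin (2 * (n - 2))) : (B'.chord q : E) = B.chord (Bouquet.rotate p (q.val + 4)) := by
    rw [hchord q]
    congr 2
    simp only [Nat.add_assoc, Nat.add_comm 4]
  have c_small {k : ℕ} (hk : k < 4) :
      B.chord (Bouquet.rotate p k) = a ∨ B.chord (Bouquet.rotate p k) = b := by
    interval_cases k <;> simp [c0, c1, c2, c3]
  have c_large {k : ℕ} (hk : 4 ≤ k) (hkn : k < 2 * n) :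
      B.chord (Bouquet.rotate p k) ≠ a ∧ B.chord (Bouquet.rotate p k) ≠ b := by
    have h := (B'.chord ⟨k - 4, by omega⟩).2
    rw [cq] at h
    simpa only [Nat.sub_add_cancel hk] using h
  have step (k : ℕ) :
      B.boundaryGraph.Reachable (Bouquet.rotate p k, true) (Bouquet.rotate p (k + 1), false) :=
    (B.boundaryGraph_adj_succ (Bouquet.rotate_val_succ p k)).reachable
  have jump {k l : ℕ} (hk : k < 4) (hl : l < 4) (hkl : k ≠ l)
      (h : B.chord (Bouquet.rotate p k) = B.chord (Bouquet.rotate p l)) (s : Bool) :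
      B.boundaryGraph.Reachable (Bouquet.rotate p k, s) (Bouquet.rotate p l, !s) := by
    refine (B.boundaryGraph_adj_chord h (rot_ne (by omega) (by omega) hkl) ?_).reachable
    rcases c_small hk with h | h <;> simp [h, hsa, hsb]
  have r0 : B.boundaryGraph.Reachable
      (Bouquet.rotate p (2 * n - 1), true) (Bouquet.rotate p 0, false) := by
    have h := step (2 * n - 1)
    rwa [Nat.sub_add_cancel (by omega), Bouquet.rotate_length] at h
  have r1 := r0.trans (jump (by omega) (by omega) (by omega) (c0.trans c2.symm) false)
  have r2 := r1.trans (step 2)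
  have r3 := r2.trans (jump (by omega) (by omega) (by omega) (c3.trans c1.symm) false)
  have r4 := r3.trans (step 1)
  have r5 := r4.trans (jump (by omega) (by omega) (by omega) (c2.trans c0.symm) false)
  have r6 := r5.trans (step 0)
  have r7 := r6.trans (jump (by omega) (by omega) (by omega) (c1.trans c3.symm) false)
  have r8 := r7.trans (step 3)
  have removed {k : ℕ} (hk : k < 4) (s : Bool) :
      B.boundaryGraph.Reachable (Bouquet.rotate p (2 * n - 1), true) (Bouquet.rotate p k, s) := by
    interval_cases k <;> cases s <;> assumption
  refine SimpleGraph.card_connectedComponent_eq_of_maps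
    (fun x => (Bouquet.rotate p (x.1.val + 4), x.2)) (Bouquet.retract p hn) ?_ ?_ ?_ ?_
  · apply B'.reachable_of_boundaryGraph_adj
    · intro i j hij
      have hi := i.isLt
      rw [Nat.mod_eq_ite_of_lt_add (by omega)] at hij
      split_ifs at hij with h
      · simpa only [hij, Nat.add_right_comm] using step (i.val + 4)
      · have hi' : i.val + 4 = 2 * n - 1 := by omega
        have hj : j.val + 4 = 4 := by omega
        simpa only [hi', hj] using r8
    · intro i j s t hc hij hst
      refine (B.boundaryGraph_adj_chord ?_ ?_ ?_).reachable
      · rw [← cq, ← cq, hc]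
      · have := Fin.val_ne_of_ne hij
        exact rot_ne (by omega) (by omega) (by simpa using this)
      · rwa [← cq, ← hsign']
  · apply B.reachable_of_boundaryGraph_adj
    · intro i j hij
      obtain ⟨k, hk, rfl⟩ := Bouquet.exists_rotate_eq p i
      obtain rfl : j = Bouquet.rotate p (k + 1) :=
        Fin.ext (hij.trans (Bouquet.rotate_val_succ p k).symm)
      by_cases hlast : k + 1 = 2 * n
      · rw [hlast, Bouquet.rotate_length, Bouquet.retract_rotate p hn hk,
          Bouquet.retract_rotate p hn (by omega), if_pos (by omega), if_neg (by omega)]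
        have : k - 4 = 2 * n - 5 := by omega
        simp only [this]
        exact SimpleGraph.Reachable.refl _
      · rw [Bouquet.retract_rotate p hn hk, Bouquet.retract_rotate p hn (by omega)]
        split_ifs with h1 h2 h2
        · refine (B'.boundaryGraph_adj_succ ?_).reachable
          simp only
          rw [Nat.mod_eq_of_lt (by omega)]
          omega
        · omega
        · refine (B'.boundaryGraph_adj_succ ?_).reachable
          simp only
          rw [Nat.mod_eq_ite_of_lt_add (by omega), if_neg (by omega)]
          omega
        · exact SimpleGraph.Reachable.refl _
    · intro i j s t hc hij hst
      obtain ⟨k, hk, rfl⟩ := Bouquet.exists_rotate_eq p i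
      obtain ⟨l, hl, rfl⟩ := Bouquet.exists_rotate_eq p j
      rw [Bouquet.retract_rotate p hn hk, Bouquet.retract_rotate p hn hl]
      split_ifs with h1 h2 h2
      · refine (B'.boundaryGraph_adj_chord (Subtype.ext ?_) ?_ ?_).reachable
        · rw [cq, cq]
          simpa only [Nat.sub_add_cancel h1, Nat.sub_add_cancel h2] using hc
        · intro h
          have h' := congrArg Fin.val h
          simp only at h'
          exact hij (congrArg (Bouquet.rotate p) (by omega))
        · rw [hsign', cq]
          simpa only [Nat.sub_add_cancel h1] using hst
      · have := c_large h1 hk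
        have := c_small (not_le.1 h2)
        grind
      · have := c_large h2 hl
        have := c_small (not_le.1 h1)
        grind
      · exact SimpleGraph.Reachable.refl _
  · rintro ⟨q, s⟩
    rw [Bouquet.retract_rotate p hn (by omega), if_pos (by omega)]
    exact SimpleGraph.Reachable.refl _
  · rintro ⟨i, s⟩
    obtain ⟨k, hk, rfl⟩ := Bouquet.exists_rotate_eq p i
    rw [Bouquet.retract_rotate p hn hk]
    split_ifs with h
    · simp only [Nat.sub_add_cancel h]
      exact SimpleGraph.Reachable.refl _
    · have : 2 * n - 5 + 4 = 2 * n - 1 := by omega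
      simp only [this]
      exact removed (not_le.1 h) s
end
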